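/- arXiv:1908.02998 — 8 statements merged into one kernel-verified Lean document; each statement's English description precedes it below -/
import Mathlib

section
/- Let X be a complex Banach space, A a bounded linear operator on X, and α₁, α₂ ∈ ℂ points outside the spectrum σ(A). Let a₁, a₂ be positive real numbers and set μ := (a₁α₂ + a₂α₁)/(a₁ + a₂). Then the operator a₁·(α₁·I − A)⁻¹ + a₂·(α₂·I − A)⁻¹ is injective if and only if μ is not an eigenvalue of A. -/
/-- For a bounded operator `A` on a complex Banach space, `α₁, α₂ ∉ σ(A)` and positive reals
`a₁, a₂`, the operator `a₁(α₁I−A)⁻¹ + a₂(α₂I−A)⁻¹` is injective iff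
`μ = (a₁α₂+a₂α₁)/(a₁+a₂)` is not an eigenvalue of `A`. -/
theorem stmt1 {X : Type*} [NormedAddCommGroup X] [NormedSpace ℂ X] [CompleteSpace X]
    (A : X →L[ℂ] X) (α₁ α₂ : ℂ) (hα₁ : α₁ ∉ spectrum ℂ A) (hα₂ : α₂ ∉ spectrum ℂ A)
    (a₁ a₂ : ℝ) (ha₁ : 0 < a₁) (ha₂ : 0 < a₂) :
    Function.Injective
      ⇑((a₁ : ℂ) • Ring.inverse (α₁ • (1 : X →L[ℂ] X) - A) +
        (a₂ : ℂ) • Ring.inverse (α₂ • (1 : X →L[ℂ] X) - A)) ↔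
      ¬∃ x : X, x ≠ 0 ∧
        A x = (((a₁ : ℂ) * α₂ + (a₂ : ℂ) * α₁) / ((a₁ : ℂ) + (a₂ : ℂ))) • x := by
  have isUnit_sub : ∀ α : ℂ, α ∉ spectrum ℂ A → IsUnit (α • (1 : X →L[ℂ] X) - A) := by
    intro α hα
    simpa [Algebra.algebraMap_eq_smul_one] using spectrum.notMem_iff.mp hα
  have hU₁ := isUnit_sub α₁ hα₁
  have hU₂ := isUnit_sub α₂ hα₂
  set U₁ : X →L[ℂ] X := α₁ • 1 - A with hU₁_def
  set U₂ : X →L[ℂ] X := α₂ • 1 - A with hU₂_def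
  set T : X →L[ℂ] X := (a₁ : ℂ) • Ring.inverse U₁ + (a₂ : ℂ) • Ring.inverse U₂ with hT
  have ha : (a₁ : ℂ) + a₂ ≠ 0 := by exact_mod_cast (add_pos ha₁ ha₂).ne'
  set μ : ℂ := ((a₁ : ℂ) * α₂ + (a₂ : ℂ) * α₁) / ((a₁ : ℂ) + (a₂ : ℂ))
  have hcomm : U₁ * U₂ = U₂ * U₁ := by
    simp only [hU₁_def, hU₂_def, sub_mul, mul_sub, smul_mul_assoc, mul_smul_comm, one_mul,
      mul_one]
    module
  have hTU : T * (U₁ * U₂) = (a₁ : ℂ) • U₂ + (a₂ : ℂ) • U₁ := by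
    rw [hT, add_mul, smul_mul_assoc, smul_mul_assoc, Ring.inverse_mul_cancel_left _ _ hU₁, hcomm,
      Ring.inverse_mul_cancel_left _ _ hU₂]
  have hμa : ((a₁ : ℂ) + a₂) * μ = a₁ * α₂ + a₂ * α₁ := mul_div_cancel₀ _ ha
  have hTU_apply : ∀ x, (T * (U₁ * U₂)) x = ((a₁ : ℂ) + a₂) • (μ • x - A x) := by
    intro x
    rw [hTU, smul_sub ((a₁ : ℂ) + a₂), smul_smul, hμa]
    simp only [hU₁_def, hU₂_def, add_apply, smul_apply,
      sub_apply, one_apply_eq_self]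
    module
  have hbij : Function.Bijective ⇑(U₁ * U₂) :=
    ContinuousLinearMap.isUnit_iff_bijective.mp (hU₁.mul hU₂)
  rw [← Function.Injective.of_comp_iff' T hbij]
  change Function.Injective ⇑(T * (U₁ * U₂)) ↔ _
  rw [injective_iff_map_eq_zero]
  simp only [hTU_apply, smul_eq_zero, ha, false_or, sub_eq_zero, not_exists, not_and']
  exact forall_congr' fun x => by rw [eq_comm, not_not]
end

section
/- Let X be a complex Banach space, A a bounded linear operator on X, and α₁, α₂ ∈ ℂ points outside the spectrum σ(A). Then the operator a₁·(α₁·I − A)⁻¹ + a₂·(α₂·I − A)⁻¹ is injective for all positive real numbers a₁, a₂ if and only if no eigenvalue of A lies in the segment [α₁, α₂] (the convex hull over ℝ of the two points α₁, α₂ in ℂ). -/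
/-- Off the spectrum, `Ring.inverse (α • 1 - A)` is a pointwise two-sided inverse. -/
theorem resolvent_apply_of_notMem_spectrum {X : Type*} [NormedAddCommGroup X] [NormedSpace ℂ X]
    {A : X →L[ℂ] X} {α : ℂ} (hα : α ∉ spectrum ℂ A) (x : X) :
    Ring.inverse (α • (1 : X →L[ℂ] X) - A) (α • x - A x) = x ∧
      α • Ring.inverse (α • (1 : X →L[ℂ] X) - A) x -
        A (Ring.inverse (α • (1 : X →L[ℂ] X) - A) x) = x := by
  have hu : IsUnit (α • (1 : X →L[ℂ] X) - A) := by
    simpa [spectrum.mem_iff, Algebra.algebraMap_eq_smul_one] using hα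
  exact ⟨congrArg (fun f : X →L[ℂ] X => f x) (Ring.inverse_mul_cancel _ hu),
    congrArg (fun f : X →L[ℂ] X => f x) (Ring.mul_inverse_cancel _ hu)⟩

/-- For a bounded operator `A` on a complex Banach space and `α₁, α₂ ∉ σ(A)`, the operators
`a₁(α₁I−A)⁻¹ + a₂(α₂I−A)⁻¹` are injective for all positive reals `a₁, a₂` iff no eigenvalue
of `A` lies in the segment `[α₁, α₂]`. -/
theorem stmt2 {X : Type*} [NormedAddCommGroup X] [NormedSpace ℂ X] [CompleteSpace X]
    (A : X →L[ℂ] X) (α₁ α₂ : ℂ) (hα₁ : α₁ ∉ spectrum ℂ A) (hα₂ : α₂ ∉ spectrum ℂ A) :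
    (∀ a₁ a₂ : ℝ, 0 < a₁ → 0 < a₂ →
      Function.Injective
        ⇑((a₁ : ℂ) • Ring.inverse (α₁ • (1 : X →L[ℂ] X) - A) +
          (a₂ : ℂ) • Ring.inverse (α₂ • (1 : X →L[ℂ] X) - A))) ↔
      ∀ μ : ℂ, (∃ x : X, x ≠ 0 ∧ A x = μ • x) → μ ∉ segment ℝ α₁ α₂ := by
  have h₁ := resolvent_apply_of_notMem_spectrum hα₁
  have h₂ := resolvent_apply_of_notMem_spectrum hα₂
  set R₁ := Ring.inverse (α₁ • (1 : X →L[ℂ] X) - A)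
  set R₂ := Ring.inverse (α₂ • (1 : X →L[ℂ] X) - A)
  have comm (y : X) : α₁ • (α₂ • y - A y) - A (α₂ • y - A y) =
      α₂ • (α₁ • y - A y) - A (α₁ • y - A y) := by
    simp only [map_sub, map_smul]
    module
  have zero₁ (y : X) (hy : α₁ • y - A y = 0) : y = 0 := by
    rw [← (h₁ y).1, hy, map_zero]
  have zero₂ (y : X) (hy : α₂ • y - A y = 0) : y = 0 := by
    rw [← (h₂ y).1, hy, map_zero]
  constructor
  · rintro h μ ⟨x, hx, hAx⟩ ⟨s, t, hs, ht, hst, rfl⟩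
    apply hx
    rcases hs.eq_or_lt with rfl | hs
    · obtain rfl : t = 1 := by linarith
      exact zero₂ x (by simp [hAx])
    rcases ht.eq_or_lt with rfl | ht
    · obtain rfl : s = 1 := by linarith
      exact zero₁ x (by simp [hAx])
    have hst' : (s : ℂ) = 1 - t := by
      rw [← Complex.ofReal_one, ← hst]
      push_cast
      ring
    refine zero₂ x (zero₁ _ ((injective_iff_map_eq_zero _).1 (h t s ht hs) _ ?_))
    simp only [add_apply, smul_apply]
    rw [(h₁ _).1, comm, (h₂ _).1, hAx]
    simp only [← Complex.coe_smul, smul_eq_mul, hst']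
    module
  · intro h a₁ a₂ ha₁ ha₂
    rw [injective_iff_map_eq_zero]
    intro x hx
    obtain ⟨y, rfl⟩ : ∃ y, α₁ • (α₂ • y - A y) - A (α₂ • y - A y) = x :=
      ⟨R₂ (R₁ x), by rw [(h₂ _).2, (h₁ _).2]⟩
    simp only [add_apply, smul_apply] at hx
    rw [(h₁ _).1, comm, (h₂ _).1] at hx
    suffices hy : y = 0 by simp [hy]
    by_contra hy
    have hsum : a₁ + a₂ ≠ 0 := by positivity
    have hsum' : (a₁ : ℂ) + a₂ ≠ 0 := by exact_mod_cast hsum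
    refine h (((a₂ / (a₁ + a₂) : ℝ)) • α₁ + ((a₁ / (a₁ + a₂) : ℝ)) • α₂) ⟨y, hy, ?_⟩
      ⟨_, _, by positivity, by positivity, by field_simp; ring, rfl⟩
    have hA : ((a₁ : ℂ) + a₂) • A y = (a₂ * α₁ + a₁ * α₂) • y := by
      rw [← sub_eq_zero, ← neg_eq_zero, ← hx]
      module
    rw [← inv_smul_smul₀ hsum' (A y), hA, smul_smul]
    congr 1
    simp only [Complex.real_smul]
    push_cast
    field_simp
end

section
/- (Lemma 2.) Let (α_j)_{j∈ℕ} be a sequence of complex numbers and (a_j)_{j∈ℕ} a summable sequence of nonnegative real numbers, not all equal to zero. If z₀ ∈ ℂ does not belong to the closure of the convex hull (over ℝ) of the set {α_j : j ∈ ℕ}, then the series ∑_{j=0}^∞ a_j/(α_j − z₀) converges absolutely and its sum is nonzero. -/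
/-- A point outside a closed convex subset of `ℂ` is strictly separated from it by the real part
of a complex multiple. -/
theorem exists_pos_lt_re_mul_sub {s : Set ℂ} (hs : Convex ℝ s) (hc : IsClosed s) {z₀ : ℂ}
    (hz₀ : z₀ ∉ s) : ∃ (c : ℂ) (δ : ℝ), 0 < δ ∧ ∀ z ∈ s, δ < (c * (z - z₀)).re := by
  obtain ⟨f, u, hu, hf⟩ := RCLike.geometric_hahn_banach_point_closed (𝕜 := ℂ) hs hc hz₀
  have hf_mul (z : ℂ) : f 1 * z = f z := by
    simpa [mul_comm] using (f.map_smul z 1).symm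
  refine ⟨f 1, u - (f z₀).re, sub_pos.2 hu, fun z hz => ?_⟩
  rw [hf_mul, map_sub, Complex.sub_re]
  exact sub_lt_sub_right (hf z hz) _

/-- Lemma 2: if `(a_j)` is a summable sequence of nonnegative reals, not all zero, and `z₀`
lies outside the closed convex hull of `{α_j}`, then `∑ a_j/(α_j − z₀)` converges absolutely
and its sum is nonzero. -/
theorem stmt3 (α : ℕ → ℂ) (a : ℕ → ℝ) (hsum : Summable a) (hnonneg : ∀ j, 0 ≤ a j)
    (hne : ∃ j, a j ≠ 0) (z₀ : ℂ)
    (hz₀ : z₀ ∉ closure (convexHull ℝ (Set.range α))) :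
    Summable (fun j => ‖(a j : ℂ) / (α j - z₀)‖) ∧
      ∑' j, (a j : ℂ) / (α j - z₀) ≠ 0 := by
  obtain ⟨c, δ, hδ, hlt⟩ :=
    exists_pos_lt_re_mul_sub (convex_convexHull ℝ (Set.range α)).closure isClosed_closure hz₀
  have hre (j : ℕ) : δ < (c * (α j - z₀)).re :=
    hlt _ (subset_closure (subset_convexHull ℝ _ (Set.mem_range_self j)))
  have hmul_ne (j : ℕ) : c * (α j - z₀) ≠ 0 := fun h => by
    have := hre j
    rw [h, Complex.zero_re] at this
    exact this.not_gt hδ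
  have habs : Summable (fun j => ‖(a j : ℂ) / (α j - z₀)‖) := by
    refine Summable.of_nonneg_of_le (fun _ => norm_nonneg _) (fun j => ?_)
      (hsum.mul_right (‖c‖ / δ))
    have hnorm : δ ≤ ‖c‖ * ‖α j - z₀‖ := by
      rw [← norm_mul]
      exact (hre j).le.trans (Complex.re_le_norm _)
    have hpos : 0 < ‖α j - z₀‖ := norm_pos_iff.2 (right_ne_zero_of_mul (hmul_ne j))
    rw [norm_div, Complex.norm_of_nonneg (hnonneg j), ← mul_div_assoc, div_le_div_iff₀ hpos hδ,
      mul_assoc]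
    exact mul_le_mul_of_nonneg_left hnorm (hnonneg j)
  refine ⟨habs, fun hzero => ?_⟩
  have hdiv := Complex.hasSum_re (habs.of_norm.hasSum.div_const c)
  rw [hzero, zero_div, Complex.zero_re] at hdiv
  have hterm (j : ℕ) : ((a j : ℂ) / (α j - z₀) / c).re =
      a j * ((c * (α j - z₀)).re / Complex.normSq (c * (α j - z₀))) := by
    rw [div_div, mul_comm (α j - z₀) c, div_eq_mul_inv, Complex.re_ofReal_mul, Complex.inv_re]
  have hfactor (j : ℕ) : 0 < (c * (α j - z₀)).re / Complex.normSq (c * (α j - z₀)) :=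
    div_pos (hδ.trans (hre j)) (Complex.normSq_pos.2 (hmul_ne j))
  simp only [hterm] at hdiv
  have hall := (hasSum_zero_iff_of_nonneg fun j => mul_nonneg (hnonneg j) (hfactor j).le).1 hdiv
  obtain ⟨j, hj⟩ := hne
  exact mul_ne_zero hj (hfactor j).ne' (congrFun hall j)
end

section
/- Let (α_j)_{j∈ℕ} be a bounded sequence of complex numbers and (a_j)_{j∈ℕ} a summable sequence of nonnegative real numbers, not all zero; set S := ∑_{j=0}^∞ a_j and P := ∑_{j=0}^∞ a_j·α_j, and for z ∈ ℂ outside the closure of the convex hull of {α_j} define f(z) = ∑_{j=0}^∞ a_j/(α_j − z) (then f(z) ≠ 0 for such z). Then 1/f(z) + z/S tends to P/S² as |z| → ∞ (i.e., along the cobounded filter on ℂ). -/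
open Filter Topology Bornology in
theorem eventually_one_le_norm_sub_of_isBounded_range {α : ℕ → ℂ}
    (hb : IsBounded (Set.range α)) : ∀ᶠ z in cobounded ℂ, ∀ j, 1 ≤ ‖α j - z‖ := by
  obtain ⟨M, hM⟩ := hb.exists_norm_le
  filter_upwards [tendsto_norm_cobounded_atTop.eventually_ge_atTop (M + 1)] with z hz j
  have h₁ : ‖α j‖ ≤ M := hM _ (Set.mem_range_self j)
  have h₂ := norm_sub_norm_le z (α j)
  rw [norm_sub_rev] at h₂
  linarith

theorem norm_div_le_of_one_le_norm (c : ℂ) {w : ℂ} (hw : 1 ≤ ‖w‖) : ‖c / w‖ ≤ ‖c‖ := by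
  rw [norm_div]
  exact div_le_self (norm_nonneg c) hw

open Filter Topology Bornology in
/-- The Cauchy transform of a summable family at bounded points vanishes at infinity. -/
theorem tendsto_tsum_div_sub_cobounded {α c : ℕ → ℂ} (hb : IsBounded (Set.range α))
    (hc : Summable c) :
    Tendsto (fun z : ℂ => ∑' j, c j / (α j - z)) (cobounded ℂ) (𝓝 0) := by
  rw [← tsum_zero (α := ℂ) (β := ℕ)]
  refine tendsto_tsum_of_dominated_convergence hc.norm (fun j => ?_) ?_
  · have h := (tendsto_inv₀_cobounded (α := ℂ)).comp (tendsto_const_sub_cobounded (α j))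
    simpa [div_eq_mul_inv] using h.const_mul (c j)
  · filter_upwards [eventually_one_le_norm_sub_of_isBounded_range hb] with z hz j
    exact norm_div_le_of_one_le_norm _ (hz j)

theorem mul_tsum_div_sub {α c : ℕ → ℂ} (hc : Summable c)
    (hcα : Summable fun j => c j * α j) {z : ℂ} (hz : ∀ j, 1 ≤ ‖α j - z‖) :
    z * ∑' j, c j / (α j - z) = ∑' j, c j * α j / (α j - z) - ∑' j, c j := by
  have hs : Summable fun j => c j * α j / (α j - z) :=
    .of_norm_bounded hcα.norm fun j => norm_div_le_of_one_le_norm _ (hz j)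
  rw [← hs.tsum_sub hc, ← tsum_mul_left]
  refine tsum_congr fun j => ?_
  have h : α j - z ≠ 0 := norm_pos_iff.mp (one_pos.trans_le (hz j))
  field_simp
  ring

theorem summable_mul_of_isBounded_range {α c : ℕ → ℂ} (hb : Bornology.IsBounded (Set.range α))
    (hc : Summable c) : Summable fun j => c j * α j := by
  obtain ⟨M, hM⟩ := hb.exists_norm_le
  refine .of_norm_bounded (hc.norm.mul_right M) fun j => ?_
  rw [norm_mul]
  exact mul_le_mul_of_nonneg_left (hM _ (Set.mem_range_self j)) (norm_nonneg _)

/-- For a bounded sequence `(α_j)` and a summable sequence of nonnegative reals `(a_j)`,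
not all zero, with `S = ∑ a_j` and `P = ∑ a_j α_j`, and `f(z) = ∑ a_j/(α_j − z)`,
the function `1/f(z) + z/S` tends to `P/S²` as `|z| → ∞`. -/
theorem stmt6 (α : ℕ → ℂ) (hb : Bornology.IsBounded (Set.range α))
    (a : ℕ → ℝ) (hsum : Summable a) (hnonneg : ∀ j, 0 ≤ a j) (hne : ∃ j, a j ≠ 0) :
    Filter.Tendsto
      (fun z : ℂ => (∑' j, (a j : ℂ) / (α j - z))⁻¹ + z / ∑' j, (a j : ℂ))
      (Bornology.cobounded ℂ)
      (nhds ((∑' j, (a j : ℂ) * α j) / (∑' j, (a j : ℂ)) ^ 2)) := by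
  have hc : Summable fun j => (a j : ℂ) := Complex.summable_ofReal.mpr hsum
  have hcα := summable_mul_of_isBounded_range hb hc
  have hcαα := summable_mul_of_isBounded_range hb hcα
  have hS : ∑' j, (a j : ℂ) ≠ 0 := by
    obtain ⟨i, hi⟩ := hne
    rw [← Complex.ofReal_tsum, Complex.ofReal_ne_zero]
    exact (hsum.tsum_pos hnonneg i ((hnonneg i).lt_of_ne' hi)).ne'
  set S := ∑' j, (a j : ℂ)
  set P := ∑' j, (a j : ℂ) * α j
  have hg := (tendsto_tsum_div_sub_cobounded hb hcα).sub_const S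
  have hh := (tendsto_tsum_div_sub_cobounded hb hcαα).sub_const P
  rw [zero_sub] at hg hh
  have hlim := hh.div (hg.const_mul S) (mul_ne_zero hS (neg_ne_zero.mpr hS))
  rw [show -P / (S * -S) = P / S ^ 2 by rw [mul_neg, neg_div_neg_eq, sq]] at hlim
  refine hlim.congr' ?_
  filter_upwards [eventually_one_le_norm_sub_of_isBounded_range hb,
    hg.eventually_ne (neg_ne_zero.mpr hS), Bornology.eventually_ne_cobounded (0 : ℂ)]
    with z hz hgz hz0
  have h₁ := mul_tsum_div_sub hc hcα hz
  have h₂ := mul_tsum_div_sub hcα hcαα hz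
  rw [Pi.div_apply, ← h₂, eq_div_of_mul_eq hz0 ((mul_comm _ _).trans h₁)]
  generalize ∑' j, (a j : ℂ) * α j / (α j - z) = g at hgz ⊢
  change _ = ((g - S) / z)⁻¹ + z / S
  field_simp
  ring
end

section
/- (Theorem 1, invertibility.) Let 𝔄 be a complex unital Banach algebra and a ∈ 𝔄. Let (α_j)_{j∈ℕ} be a bounded sequence of complex numbers such that the spectrum σ(a) is disjoint from the closure of the convex hull (over ℝ) of {α_j : j ∈ ℕ}, and let (a_j)_{j∈ℕ} be a summable sequence of nonnegative real numbers with ∑ a_j > 0. Then the element f(a) := ∑_{j=0}^∞ a_j·(α_j·1 − a)⁻¹ (the series converges in norm) is invertible in 𝔄. -/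
/-- Nonnegative combinations of the `(α j - z)⁻¹` do not vanish when `z` is strictly separated
from the points `α j`. -/
theorem not_hasSum_inv_sub_zero {α : ℕ → ℂ} {z : ℂ}
    (hz : z ∉ closure (convexHull ℝ (Set.range α))) {a : ℕ → ℝ} (hnonneg : ∀ j, 0 ≤ a j)
    (hS : 0 < ∑' j, a j) : ¬ HasSum (fun j => (a j : ℂ) * (α j - z)⁻¹) 0 := by
  intro h
  obtain ⟨f, u, hu, hf⟩ :=
    geometric_hahn_banach_point_closed (convex_convexHull ℝ (Set.range α)).closure
      isClosed_closure hz
  have hpos (j : ℕ) : 0 < f (α j - z) := by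
    have := hf (α j) (subset_closure (subset_convexHull ℝ _ ⟨j, rfl⟩))
    rw [map_sub]
    linarith
  have hne (j : ℕ) : α j - z ≠ 0 := fun h0 => by simpa [h0] using hpos j
  have key (j : ℕ) : (f ∘L (Complex.conjCLE : ℂ →L[ℝ] ℂ)) ((a j : ℂ) * (α j - z)⁻¹) =
      a j * ((Complex.normSq (α j - z))⁻¹ * f (α j - z)) := by
    have : (starRingEnd ℂ) ((a j : ℂ) * (α j - z)⁻¹) =
        (a j * (Complex.normSq (α j - z))⁻¹) • (α j - z) := by
      rw [Complex.inv_def, Complex.real_smul]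
      simp only [map_mul, Complex.conj_conj, Complex.conj_ofReal]
      push_cast
      ring
    rw [ContinuousLinearMap.comp_apply, ContinuousLinearEquiv.coe_coe, Complex.conjCLE_apply, this,
      map_smul, smul_eq_mul, mul_assoc]
  have hg := h.mapL (f ∘L (Complex.conjCLE : ℂ →L[ℝ] ℂ))
  simp only [key, map_zero] at hg
  have hfac (j : ℕ) : 0 < (Complex.normSq (α j - z))⁻¹ * f (α j - z) :=
    mul_pos (inv_pos.2 (Complex.normSq_pos.2 (hne j))) (hpos j)
  have hzero := (hasSum_zero_iff_of_nonneg fun j => mul_nonneg (hnonneg j) (hfac j).le).1 hg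
  have ha : a = 0 := funext fun j =>
    (mul_eq_zero.1 (congrFun hzero j)).resolve_right (hfac j).ne'
  simp [ha] at hS

/-- The inverse of a unit lies in every centralizer containing the unit. -/
theorem Subalgebra.ringInverse_mem_centralizer {R A : Type*} [CommSemiring R] [Ring A]
    [Algebra R A] {s : Set A} {x : A} (hx : x ∈ Subalgebra.centralizer R s) (hu : IsUnit x) :
    Ring.inverse x ∈ Subalgebra.centralizer R s := by
  obtain ⟨v, rfl⟩ := hu
  rw [Ring.inverse_unit, Subalgebra.mem_centralizer_iff]
  intro g hg
  exact Commute.units_inv_right (Subalgebra.mem_centralizer_iff R |>.1 hx g hg)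

/-- The double centralizer of an element of a Banach algebra is a commutative Banach algebra. -/
noncomputable abbrev doubleCentralizerNormedCommRing {A : Type*} [NormedRing A] [NormedAlgebra ℂ A]
    (t : A) : NormedCommRing (Subalgebra.centralizer ℂ (Set.centralizer {t})) where
  __ := (inferInstance : NormedRing (Subalgebra.centralizer ℂ (Set.centralizer {t})))
  mul_comm x y := Subtype.ext <|
    Set.centralizer_centralizer_comm_of_comm (by simp) _ x.2 _ y.2

theorem isUnit_of_forall_algHom_ne_zero {A : Type*} [NormedRing A] [NormedAlgebra ℂ A]
    [CompleteSpace A] {t : A} (x : Subalgebra.centralizer ℂ (Set.centralizer {t}))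
    (hx : ∀ φ : Subalgebra.centralizer ℂ (Set.centralizer {t}) →ₐ[ℂ] ℂ,
      Continuous φ → φ x ≠ 0) : IsUnit (x : A) := by
  let := doubleCentralizerNormedCommRing t
  have : CompleteSpace (Subalgebra.centralizer ℂ (Set.centralizer {t})) :=
    (Set.isClosed_centralizer (M := A) _).completeSpace_coe
  let : NormedAlgebra ℂ (Subalgebra.centralizer ℂ (Set.centralizer {t})) :=
    { norm_smul_le := norm_smul_le }
  suffices h : IsUnit x from h.map (Subalgebra.centralizer ℂ (Set.centralizer {t})).val
  by_contra h
  obtain ⟨f, hf⟩ := WeakDual.CharacterSpace.exists_apply_eq_zero h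
  exact hx (WeakDual.CharacterSpace.toAlgHom f) (map_continuous f) hf

theorem isUnit_smul_one_sub {A : Type*} [Ring A] [Algebra ℂ A] {t : A} {z : ℂ}
    (hz : z ∉ spectrum ℂ t) : IsUnit (z • (1 : A) - t) := by
  rwa [spectrum.notMem_iff, Algebra.algebraMap_eq_smul_one] at hz

/-- The resolvent is bounded on every bounded set whose closure avoids the spectrum. -/
theorem exists_norm_resolvent_le {A : Type*} [NormedRing A] [NormedAlgebra ℂ A] [CompleteSpace A]
    {t : A} {s : Set ℂ} (hb : Bornology.IsBounded s) (hs : Disjoint (spectrum ℂ t) (closure s)) :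
    ∃ C, ∀ z ∈ s, ‖Ring.inverse (z • (1 : A) - t)‖ ≤ C := by
  have hcont : ContinuousOn (fun z : ℂ => Ring.inverse (z • (1 : A) - t)) (closure s) := by
    intro z hz
    have hu := isUnit_smul_one_sub (hs.notMem_of_mem_right hz)
    have h : ContinuousAt Ring.inverse (z • (1 : A) - t) := by
      simpa using NormedRing.inverse_continuousAt hu.unit
    exact (ContinuousAt.comp (f := fun z : ℂ => z • (1 : A) - t) h
      (by fun_prop)).continuousWithinAt
  obtain ⟨C, hC⟩ := hb.isCompact_closure.exists_bound_of_continuousOn hcont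
  exact ⟨C, fun z hz => hC z (subset_closure hz)⟩

/-- Theorem 1 (invertibility): if `σ(t)` is disjoint from the closed convex hull of the
bounded set `{α_j}` and `(a_j)` is a summable sequence of nonnegative reals with positive
sum, then `f(t) = ∑ a_j (α_j·1 − t)⁻¹` converges in norm and is invertible in `𝔄`. -/
theorem stmt7 {𝔄 : Type*} [NormedRing 𝔄] [NormedAlgebra ℂ 𝔄] [CompleteSpace 𝔄]
    (t : 𝔄) (α : ℕ → ℂ) (hb : Bornology.IsBounded (Set.range α))
    (hdisj : Disjoint (spectrum ℂ t) (closure (convexHull ℝ (Set.range α))))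
    (a : ℕ → ℝ) (hsum : Summable a) (hnonneg : ∀ j, 0 ≤ a j) (hS : 0 < ∑' j, a j) :
    Summable (fun j => (a j : ℂ) • Ring.inverse (α j • (1 : 𝔄) - t)) ∧
      IsUnit (∑' j, (a j : ℂ) • Ring.inverse (α j • (1 : 𝔄) - t)) := by
  have hunit (j : ℕ) : IsUnit (α j • (1 : 𝔄) - t) := isUnit_smul_one_sub <|
    hdisj.notMem_of_mem_right (subset_closure (subset_convexHull ℝ _ ⟨j, rfl⟩))
  have hsummable : Summable (fun j => (a j : ℂ) • Ring.inverse (α j • (1 : 𝔄) - t)) := by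
    obtain ⟨C, hC⟩ := exists_norm_resolvent_le hb
      (hdisj.mono_right (closure_mono (subset_convexHull ℝ _)))
    refine Summable.of_norm_bounded (hsum.mul_right C) fun j => ?_
    rw [norm_smul, Complex.norm_of_nonneg (hnonneg j)]
    exact mul_le_mul_of_nonneg_left (hC _ ⟨j, rfl⟩) (hnonneg j)
  refine ⟨hsummable, ?_⟩
  let B := Subalgebra.centralizer ℂ (Set.centralizer {t})
  have htB : t ∈ B := Set.subset_centralizer_centralizer rfl
  have hlin (z : ℂ) : z • (1 : 𝔄) - t ∈ B := B.sub_mem (B.smul_mem B.one_mem z) htB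
  let T : B := ⟨t, htB⟩
  let R (j : ℕ) : B := ⟨Ring.inverse (α j • (1 : 𝔄) - t),
    Subalgebra.ringInverse_mem_centralizer (hlin _) (hunit j)⟩
  have hF : ∑' j, (a j : ℂ) • Ring.inverse (α j • (1 : 𝔄) - t) ∈ B :=
    (Set.isClosed_centralizer (M := 𝔄) _).mem_of_tendsto hsummable.hasSum <|
      Filter.Eventually.of_forall fun s =>
        B.sum_mem fun j _ => B.smul_mem (R j).2 _
  have hsumB : HasSum (fun j => (a j : ℂ) • R j) (⟨_, hF⟩ : B) :=
    (Topology.IsInducing.subtypeVal.hasSum_iff (g := B.val) _ _).1 hsummable.hasSum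
  refine isUnit_of_forall_algHom_ne_zero (⟨_, hF⟩ : B) fun φ hφ h0 => ?_
  have hspec : φ T ∈ spectrum ℂ t := by
    by_contra hz
    have hu := isUnit_smul_one_sub hz
    have hmul : (φ T • (1 : B) - T) *
        ⟨_, Subalgebra.ringInverse_mem_centralizer (hlin (φ T)) hu⟩ = 1 :=
      Subtype.ext (Ring.mul_inverse_cancel _ hu)
    simpa using congrArg φ hmul
  have hR (j : ℕ) : φ (R j) = (α j - φ T)⁻¹ := by
    have hmul : (α j • (1 : B) - T) * R j = 1 :=
      Subtype.ext (Ring.mul_inverse_cancel _ (hunit j))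
    have := congrArg φ hmul
    rw [map_mul, map_sub, map_smul, map_one, smul_eq_mul, mul_one] at this
    exact eq_inv_of_mul_eq_one_right this
  have hφsum := hsumB.map φ hφ
  rw [h0] at hφsum
  refine not_hasSum_inv_sub_zero (hdisj.notMem_of_mem_left hspec) hnonneg hS ?_
  have hterm : (φ ∘ fun j => (a j : ℂ) • R j) = fun j => (a j : ℂ) * (α j - φ T)⁻¹ :=
    funext fun j => by rw [Function.comp_apply, map_smul, hR, smul_eq_mul]
  rwa [hterm] at hφsum
end

section
/- Let S be a subset of ℂ and let λ ∈ ℂ belong to the convex hull (over ℝ) of S but not to S itself. Then there exist points β₁, β₂, β₃ ∈ S and nonnegative real numbers a₁, a₂, a₃, not all zero, such that a₁/(β₁ − λ) + a₂/(β₂ − λ) + a₃/(β₃ − λ) = 0. -/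
/-- Carathéodory's theorem in the plane, with the convex combination padded to exactly three
points (repetitions and zero weights being allowed). -/
theorem exists_fin_three_combination_of_mem_convexHull {S : Set ℂ} {x : ℂ}
    (hx : x ∈ convexHull ℝ S) :
    ∃ (z : Fin 3 → ℂ) (w : Fin 3 → ℝ), (∀ i, z i ∈ S) ∧ (∀ i, 0 ≤ w i) ∧
      ∑ i, w i = 1 ∧ ∑ i, w i • z i = x := by
  obtain ⟨ι, _, z, w, hz, hind, hw, hw1, hsum⟩ := eq_pos_convex_span_of_mem_convexHull hx
  have hcard : Fintype.card ι ≤ Fintype.card (Fin 3) := by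
    have h₁ := hind.card_le_finrank_succ
    have h₂ := (vectorSpan ℝ (Set.range z)).finrank_le
    rw [Complex.finrank_real_complex] at h₂
    rw [Fintype.card_fin]
    lia
  obtain ⟨e⟩ := Function.Embedding.nonempty_of_card_le hcard
  obtain ⟨x₀, hx₀⟩ := convexHull_nonempty_iff.mp ⟨x, hx⟩
  have extend_zero : ∀ j ∉ Set.range e, Function.extend e w 0 j = 0 := fun j hj ↦
    Function.extend_apply' _ _ _ hj
  refine ⟨Function.extend e z fun _ ↦ x₀, Function.extend e w 0, fun j ↦ ?_, fun j ↦ ?_, ?_, ?_⟩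
  · by_cases hj : j ∈ Set.range e
    · obtain ⟨i, rfl⟩ := hj
      rw [e.injective.extend_apply]
      exact hz ⟨i, rfl⟩
    · rwa [Function.extend_apply' _ _ _ hj]
  · by_cases hj : j ∈ Set.range e
    · obtain ⟨i, rfl⟩ := hj
      rw [e.injective.extend_apply]
      exact (hw i).le
    · rw [extend_zero j hj]
  · rw [← hw1]
    exact (Fintype.sum_of_injective e e.injective _ _ extend_zero
      fun i ↦ (e.injective.extend_apply _ _ i).symm).symm
  · rw [← hsum]
    refine (Fintype.sum_of_injective e e.injective _ _ (fun j hj ↦ ?_) fun i ↦ ?_).symm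
    · rw [extend_zero j hj, zero_smul]
    · simp only [e.injective.extend_apply]

theorem Complex.ofReal_mul_normSq_div_self (w : ℝ) (z : ℂ) :
    ((w * Complex.normSq z : ℝ) : ℂ) / z = w * starRingEnd ℂ z := by
  rcases eq_or_ne z 0 with rfl | hz
  · simp
  · rw [div_eq_iff hz, Complex.ofReal_mul, Complex.normSq_eq_conj_mul_self, mul_assoc]


/-- If `λ` belongs to the convex hull of `S ⊆ ℂ` but not to `S`, then there are points
`β₁, β₂, β₃ ∈ S` and nonnegative reals `a₁, a₂, a₃`, not all zero, with
`a₁/(β₁−λ) + a₂/(β₂−λ) + a₃/(β₃−λ) = 0`. -/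
theorem stmt9 (S : Set ℂ) (lam : ℂ) (hlam : lam ∈ convexHull ℝ S) (hlamS : lam ∉ S) :
    ∃ β₁ β₂ β₃ : ℂ, β₁ ∈ S ∧ β₂ ∈ S ∧ β₃ ∈ S ∧
      ∃ a₁ a₂ a₃ : ℝ, 0 ≤ a₁ ∧ 0 ≤ a₂ ∧ 0 ≤ a₃ ∧ ¬(a₁ = 0 ∧ a₂ = 0 ∧ a₃ = 0) ∧
        (a₁ : ℂ) / (β₁ - lam) + (a₂ : ℂ) / (β₂ - lam) + (a₃ : ℂ) / (β₃ - lam) = 0 := by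
  obtain ⟨z, w, hz, hw, hw1, hsum⟩ := exists_fin_three_combination_of_mem_convexHull hlam
  have hpos : ∀ i, 0 < Complex.normSq (z i - lam) := fun i ↦
    Complex.normSq_pos.mpr (sub_ne_zero.mpr fun h ↦ hlamS (h ▸ hz i))
  have hnonneg : ∀ i, 0 ≤ w i * Complex.normSq (z i - lam) := fun i ↦
    mul_nonneg (hw i) (hpos i).le
  refine ⟨z 0, z 1, z 2, hz 0, hz 1, hz 2, _, _, _, hnonneg 0, hnonneg 1, hnonneg 2, ?_, ?_⟩
  · rintro ⟨h₀, h₁, h₂⟩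
    rw [mul_eq_zero_iff_right (hpos _).ne'] at h₀ h₁ h₂
    simp [Fin.sum_univ_three, h₀, h₁, h₂] at hw1
  · simp only [Complex.ofReal_mul_normSq_div_self]
    simp only [Fin.sum_univ_three, Complex.real_smul] at hw1 hsum
    have hw1' : (w 0 : ℂ) + w 1 + w 2 = 1 := by exact_mod_cast hw1
    have key : (w 0 : ℂ) * (z 0 - lam) + w 1 * (z 1 - lam) + w 2 * (z 2 - lam) = 0 := by
      linear_combination hsum - lam * hw1'
    simpa only [map_add, map_mul, Complex.conj_ofReal, map_zero] using
      congrArg (starRingEnd ℂ) key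
end

section
/- (Proposition 1.) Let X be a complex Banach space, A a bounded linear operator on X, and (α_j)_{j∈ℕ} a sequence of complex numbers with α_j ∉ σ(A) for every j. Suppose λ is an eigenvalue of A that belongs to the convex hull (over ℝ) of the set {α_j : j ∈ ℕ} but λ ∉ {α_j : j ∈ ℕ}. Then there exist indices j₁, j₂, j₃ and nonnegative real numbers a₁, a₂, a₃, not all zero, such that the operator a₁·(α_{j₁}·I − A)⁻¹ + a₂·(α_{j₂}·I − A)⁻¹ + a₃·(α_{j₃}·I − A)⁻¹ is not injective. -/
/-- Carathéodory's theorem in the complex plane, for an indexed family: a point of the convex hull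
is a convex combination of three (possibly repeated) members of the family. -/
theorem Complex.exists_fin_three_of_mem_convexHull_range {ι : Type*} {α : ι → ℂ} {z : ℂ}
    (hz : z ∈ convexHull ℝ (Set.range α)) :
    ∃ (j : Fin 3 → ι) (w : Fin 3 → ℝ), (∀ i, 0 ≤ w i) ∧ ∑ i, w i = 1 ∧
      ∑ i, w i • α (j i) = z := by
  obtain ⟨κ, _, p, w, hp, hind, hw, hsum, hcomb⟩ := eq_pos_convex_span_of_mem_convexHull hz
  have hcard : Fintype.card κ ≤ Fintype.card (Fin 3) := by
    have h := hind.card_le_finrank_succ.trans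
      (Nat.succ_le_succ (Submodule.finrank_le (vectorSpan ℝ (Set.range p))))
    simpa [Complex.finrank_real_complex] using h
  obtain ⟨e⟩ := Function.Embedding.nonempty_of_card_le hcard
  choose k hk using fun i : κ ↦ hp ⟨i, rfl⟩
  obtain ⟨i₀⟩ : Nonempty ι := by
    by_contra h
    rw [not_nonempty_iff] at h
    simp [Set.range_eq_empty] at hz
  refine ⟨Function.extend e k fun _ ↦ i₀, Function.extend e w 0, fun i ↦ ?_, ?_, ?_⟩
  · by_cases h : ∃ a, e a = i
    · obtain ⟨a, rfl⟩ := h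
      rw [e.injective.extend_apply]
      exact (hw a).le
    · simp [Function.extend_apply' _ _ _ h]
  · rw [← hsum]
    refine (Fintype.sum_of_injective e e.injective _ _ (fun i hi ↦ ?_) fun i ↦ ?_).symm
    · simp [Function.extend_apply' _ _ _ hi]
    · rw [e.injective.extend_apply]
  · rw [← hcomb]
    refine (Fintype.sum_of_injective e e.injective _ _ (fun i hi ↦ ?_) fun i ↦ ?_).symm
    · simp [Function.extend_apply' _ _ _ hi]
    · rw [e.injective.extend_apply, e.injective.extend_apply, hk]

/-- The resolvent at `μ` acts on an eigenvector with eigenvalue `z` as `(μ - z)⁻¹`. -/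
theorem ContinuousLinearMap.ringInverse_smul_one_sub_apply {𝕜 X : Type*}
    [NontriviallyNormedField 𝕜] [NormedAddCommGroup X] [NormedSpace 𝕜 X] {A : X →L[𝕜] X} {μ z : 𝕜}
    {x : X} (hμ : μ ∉ spectrum 𝕜 A) (hne : μ ≠ z) (hx : A x = z • x) :
    Ring.inverse (μ • (1 : X →L[𝕜] X) - A) x = (μ - z)⁻¹ • x := by
  have hu : IsUnit (μ • (1 : X →L[𝕜] X) - A) := by
    rwa [spectrum.notMem_iff, Algebra.algebraMap_eq_smul_one] at hμ
  have happ : (μ • (1 : X →L[𝕜] X) - A) x = (μ - z) • x := by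
    simp [hx, sub_smul]
  have hinv := DFunLike.congr_fun (Ring.inverse_mul_cancel _ hu) x
  rw [mul_apply_eq_comp, happ, map_smul, one_apply_eq_self] at hinv
  rw [eq_inv_smul_iff₀ (sub_ne_zero.2 hne), hinv]

/-- If `∑ wᵢ • βᵢ = 0` with all `βᵢ` nonzero, then `∑ (wᵢ ‖βᵢ‖²) βᵢ⁻¹ = 0`. -/
theorem Complex.sum_mul_normSq_mul_inv_eq_zero {ι : Type*} [Fintype ι] {w : ι → ℝ} {β : ι → ℂ}
    (hβ : ∀ i, β i ≠ 0) (h : ∑ i, w i • β i = 0) :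
    ∑ i, ((w i * Complex.normSq (β i) : ℝ) : ℂ) * (β i)⁻¹ = 0 := by
  have hconj := congrArg (starRingEnd ℂ) h
  rw [map_sum, map_zero] at hconj
  rw [← hconj]
  refine Finset.sum_congr rfl fun i _ ↦ ?_
  have := hβ i
  rw [Complex.ofReal_mul, ← Complex.mul_conj, Complex.real_smul, map_mul, Complex.conj_ofReal]
  field_simp

/-- Proposition 1: if an eigenvalue `λ` of a bounded operator `A` lies in the convex hull
of `{α_j}` but not in `{α_j}` itself, then some nonnegative combination of three resolvents
`a₁(α_{j₁}I−A)⁻¹ + a₂(α_{j₂}I−A)⁻¹ + a₃(α_{j₃}I−A)⁻¹` (not all coefficients zero) fails to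
be injective. -/
theorem stmt10 {X : Type*} [NormedAddCommGroup X] [NormedSpace ℂ X] [CompleteSpace X]
    (A : X →L[ℂ] X) (α : ℕ → ℂ) (hα : ∀ j, α j ∉ spectrum ℂ A)
    (lam : ℂ) (heig : ∃ x : X, x ≠ 0 ∧ A x = lam • x)
    (hconv : lam ∈ convexHull ℝ (Set.range α)) (hnot : lam ∉ Set.range α) :
    ∃ j₁ j₂ j₃ : ℕ, ∃ a₁ a₂ a₃ : ℝ, 0 ≤ a₁ ∧ 0 ≤ a₂ ∧ 0 ≤ a₃ ∧
      ¬(a₁ = 0 ∧ a₂ = 0 ∧ a₃ = 0) ∧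
      ¬Function.Injective
        ⇑((a₁ : ℂ) • Ring.inverse (α j₁ • (1 : X →L[ℂ] X) - A) +
          (a₂ : ℂ) • Ring.inverse (α j₂ • (1 : X →L[ℂ] X) - A) +
          (a₃ : ℂ) • Ring.inverse (α j₃ • (1 : X →L[ℂ] X) - A)) := by
  obtain ⟨x, hx0, hx⟩ := heig
  obtain ⟨j, w, hw, hsum, hcomb⟩ := Complex.exists_fin_three_of_mem_convexHull_range hconv
  have hne (i : ℕ) : α i ≠ lam := fun h ↦ hnot ⟨i, h⟩
  have hβ (i : Fin 3) : α (j i) - lam ≠ 0 := sub_ne_zero.2 (hne _)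
  have hzero : ∑ i, w i • (α (j i) - lam) = 0 := by
    simp_rw [smul_sub]
    rw [Finset.sum_sub_distrib, hcomb, ← Finset.sum_smul, hsum, one_smul, sub_self]
  have hres := Complex.sum_mul_normSq_mul_inv_eq_zero hβ hzero
  let a (i : Fin 3) : ℝ := w i * Complex.normSq (α (j i) - lam)
  have ha (i : Fin 3) : 0 ≤ a i := mul_nonneg (hw i) (Complex.normSq_nonneg _)
  have hwa {i : Fin 3} (h : a i = 0) : w i = 0 :=
    (mul_eq_zero.1 h).resolve_right (Complex.normSq_pos.2 (hβ i)).ne'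
  refine ⟨j 0, j 1, j 2, a 0, a 1, a 2, ha 0, ha 1, ha 2, ?_, fun hinj ↦ hx0 (hinj ?_)⟩
  · rintro ⟨h0, h1, h2⟩
    simp [Fin.sum_univ_three, hwa h0, hwa h1, hwa h2] at hsum
  · rw [Fin.sum_univ_three] at hres
    simp only [add_apply, smul_apply, map_zero,
      ContinuousLinearMap.ringInverse_smul_one_sub_apply (hα _) (hne _) hx, smul_smul, ← add_smul]
    rw [hres, zero_smul]
end

section
/- Let β ∈ ℂ with Im β < 0 and let x : ℝ → ℂ be continuous with compact support. Define u(t) := (i/(2β)) ∫_{−∞}^∞ e^{−iβ|s−t|} x(s) ds. Then u is twice differentiable on ℝ and u''(t) + β²·u(t) = x(t) for every t ∈ ℝ; i.e., u solves the resolvent equation (β² − H)u = x for the operator H = −d²/dt². -/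
open MeasureTheory Set

theorem hasDerivAt_integral_Iic {f : ℝ → ℂ} (hf : Continuous f) (hfi : Integrable f) (t : ℝ) :
    HasDerivAt (fun r : ℝ => ∫ s in Iic r, f s) (f t) t := by
  have h : (fun r : ℝ => ∫ s in Iic r, f s)
      = fun r => (∫ s in Iic 0, f s) + ∫ s in (0 : ℝ)..r, f s := by
    funext r
    rw [← intervalIntegral.integral_Iic_sub_Iic hfi.integrableOn hfi.integrableOn]
    ring
  rw [h]
  exact (hf.integral_hasStrictDerivAt 0 t).hasDerivAt.const_add _

theorem hasDerivAt_integral_Ioi {f : ℝ → ℂ} (hf : Continuous f) (hfi : Integrable f) (t : ℝ) :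
    HasDerivAt (fun r : ℝ => ∫ s in Ioi r, f s) (-f t) t := by
  have h : (fun r : ℝ => ∫ s in Ioi r, f s)
      = fun r => (∫ s, f s) - ∫ s in Iic r, f s := by
    funext r
    rw [← intervalIntegral.integral_Iic_add_Ioi hfi.integrableOn (b := r) hfi.integrableOn]
    ring
  rw [h]
  exact (hasDerivAt_integral_Iic hf hfi t).const_sub _

theorem hasDerivAt_cexp_mul_ofReal (c : ℂ) (t : ℝ) :
    HasDerivAt (fun r : ℝ => Complex.exp (c * r)) (c * Complex.exp (c * t)) t := by
  simpa [mul_comm] using (((hasDerivAt_id (t : ℂ)).const_mul c).cexp).comp_ofReal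

theorem integrable_cexp_mul {x : ℝ → ℂ} (hx : Continuous x) (hsupp : HasCompactSupport x) (c : ℂ) :
    Integrable fun s : ℝ => Complex.exp (c * s) * x s :=
  Continuous.integrable_of_hasCompactSupport (by fun_prop) hsupp.mul_left

/-- Splitting the convolution with `exp (-c |·|)` at the kink of the kernel. -/
theorem integral_cexp_neg_mul_abs_sub {x : ℝ → ℂ} (hx : Continuous x) (hsupp : HasCompactSupport x)
    (c : ℂ) (t : ℝ) :
    ∫ s : ℝ, Complex.exp (-c * ((|s - t| : ℝ) : ℂ)) * x s
      = Complex.exp (-c * t) * (∫ s in Iic t, Complex.exp (c * s) * x s)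
        + Complex.exp (c * t) * ∫ s in Ioi t, Complex.exp (-c * s) * x s := by
  have hi : Integrable fun s : ℝ => Complex.exp (-c * ((|s - t| : ℝ) : ℂ)) * x s :=
    Continuous.integrable_of_hasCompactSupport (by fun_prop) hsupp.mul_left
  rw [← intervalIntegral.integral_Iic_add_Ioi hi.integrableOn (b := t) hi.integrableOn,
    ← integral_const_mul, ← integral_const_mul]
  congr 1
  · refine setIntegral_congr_fun measurableSet_Iic fun s hs => ?_
    rw [abs_of_nonpos (sub_nonpos.2 hs), ← mul_assoc, ← Complex.exp_add]
    push_cast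
    ring_nf
  · refine setIntegral_congr_fun measurableSet_Ioi fun s hs => ?_
    rw [abs_of_pos (sub_pos.2 hs), ← mul_assoc, ← Complex.exp_add]
    push_cast
    ring_nf

/-- For `Im β < 0` and `x : ℝ → ℂ` continuous with compact support, the function
`u(t) = (i/(2β)) ∫_{−∞}^∞ e^{−iβ|s−t|} x(s) ds` is twice differentiable and satisfies
`u''(t) + β² u(t) = x(t)` for all `t`. -/
theorem stmt14 (β : ℂ) (hβ : β.im < 0) (x : ℝ → ℂ) (hx : Continuous x)
    (hsupp : HasCompactSupport x) :
    let u : ℝ → ℂ := fun t =>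
      (Complex.I / (2 * β)) * ∫ s : ℝ, Complex.exp (-Complex.I * β * ((|s - t| : ℝ) : ℂ)) * x s
    (∀ t : ℝ, DifferentiableAt ℝ u t) ∧
      (∀ t : ℝ, DifferentiableAt ℝ (deriv u) t) ∧
      ∀ t : ℝ, deriv (deriv u) t + β ^ 2 * u t = x t := by
  intro u
  have hβ0 : β ≠ 0 := by
    rintro rfl
    simp at hβ
  set c : ℂ := Complex.I * β with hc
  have hc2 : c ^ 2 = -β ^ 2 := by rw [hc, mul_pow, Complex.I_sq]; ring
  have hcI : Complex.I / (2 * β) * (2 * c) = -1 := by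
    rw [hc]
    field_simp
    exact Complex.I_sq
  let A : ℝ → ℂ := fun t => ∫ s in Iic t, Complex.exp (c * s) * x s
  let B : ℝ → ℂ := fun t => ∫ s in Ioi t, Complex.exp (-c * s) * x s
  have hu : u = fun t : ℝ => Complex.I / (2 * β) *
      (Complex.exp (-c * t) * A t + Complex.exp (c * t) * B t) := by
    funext t
    simp only [u, A, B]
    rw [← integral_cexp_neg_mul_abs_sub hx hsupp c t, hc, neg_mul]
  have hA (t : ℝ) : HasDerivAt A (Complex.exp (c * t) * x t) t :=
    hasDerivAt_integral_Iic (by fun_prop) (integrable_cexp_mul hx hsupp c) t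
  have hB (t : ℝ) : HasDerivAt B (-(Complex.exp (-c * t) * x t)) t :=
    hasDerivAt_integral_Ioi (by fun_prop) (integrable_cexp_mul hx hsupp (-c)) t
  have hP (t : ℝ) := (hasDerivAt_cexp_mul_ofReal (-c) t).mul (hA t)
  have hQ (t : ℝ) := (hasDerivAt_cexp_mul_ofReal c t).mul (hB t)
  have hE (t : ℝ) : Complex.exp (-c * t) * Complex.exp (c * t) = 1 := by
    rw [← Complex.exp_add]
    simp
  have hu1 (t : ℝ) : HasDerivAt u (Complex.I / (2 * β) *
      (c * (Complex.exp (c * t) * B t - Complex.exp (-c * t) * A t))) t := by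
    rw [hu]
    refine (((hP t).add (hQ t)).const_mul (Complex.I / (2 * β))).congr_deriv ?_
    ring
  have hdu : deriv u = fun t : ℝ => Complex.I / (2 * β) *
      (c * (Complex.exp (c * t) * B t - Complex.exp (-c * t) * A t)) :=
    funext fun t => (hu1 t).deriv
  have hu2 (t : ℝ) : HasDerivAt (deriv u) (x t - β ^ 2 * u t) t := by
    rw [hdu]
    refine ((((hQ t).sub (hP t)).const_mul c).const_mul (Complex.I / (2 * β))).congr_deriv ?_
    rw [hu]
    linear_combination (Complex.I / (2 * β) *
      (Complex.exp (-c * t) * A t + Complex.exp (c * t) * B t)) * hc2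
      - Complex.I / (2 * β) * (2 * c) * x t * hE t - x t * hcI
  refine ⟨fun t => (hu1 t).differentiableAt, fun t => (hu2 t).differentiableAt, fun t => ?_⟩
  rw [(hu2 t).deriv]
  ring
end
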